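/- arXiv:1802.03300 — 6 statements merged into one kernel-verified Lean document; each statement's English description precedes it below -/
import Mathlib

section
/- Let 1 ≤ m < n, let M = {i_1 < ⋯ < i_m} ⊂ {1,…,n}, let r_x, r_y ∈ S_n and r_y* ∈ S_m, and set r_x* = rank(r_x(i_1),…,r_x(i_m)) ∈ S_m, s* = r_y* ∘ (r_x*)^{-1} ∈ S_m, and M* = {r_x(i_1),…,r_x(i_m)} ⊂ {1,…,n}. Then r_y ∈ C(r_y*, M) if and only if r_y ∘ r_x^{-1} ∈ C(s*, M*). -/
open Finset

/-- The rank permutation of a vector `x ∈ ℝⁿ` with pairwise distinct coordinates: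
`rankPerm x i` is (in zero-based indexing) `#{j : x j ≤ x i} - 1`.  For vectors with
ties we set `rankPerm x = 1` (the identity permutation). -/
noncomputable def rankPerm {n : ℕ} (x : Fin n → ℝ) : Equiv.Perm (Fin n) := by
  classical
  exact if hx : Function.Injective x then
    Equiv.ofBijective
      (fun i => ⟨(Finset.univ.filter fun j => x j ≤ x i).card - 1, by
        have h1 : 0 < (Finset.univ.filter fun j => x j ≤ x i).card :=
          Finset.card_pos.mpr ⟨i, by simp⟩
        have h2 : (Finset.univ.filter fun j => x j ≤ x i).card ≤ n := by
          simpa using Finset.card_filter_le Finset.univ fun j => x j ≤ x i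
        omega⟩)
      (by
        rw [← Finite.injective_iff_bijective]
        intro i i' h
        simp only [Fin.mk.injEq] at h
        have h1 : 0 < (Finset.univ.filter fun j => x j ≤ x i).card :=
          Finset.card_pos.mpr ⟨i, by simp⟩
        have h1' : 0 < (Finset.univ.filter fun j => x j ≤ x i').card :=
          Finset.card_pos.mpr ⟨i', by simp⟩
        have hcard : (Finset.univ.filter fun j => x j ≤ x i).card
            = (Finset.univ.filter fun j => x j ≤ x i').card := by omega
        have key : ∀ a b : Fin n, x a ≤ x b →
            (Finset.univ.filter fun j => x j ≤ x a).card
              = (Finset.univ.filter fun j => x j ≤ x b).card → a = b := by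
          intro a b hab hc
          have hsub : (Finset.univ.filter fun j => x j ≤ x a)
              ⊆ (Finset.univ.filter fun j => x j ≤ x b) := by
            intro j hj
            simp only [Finset.mem_filter, Finset.mem_univ, true_and] at hj ⊢
            exact hj.trans hab
          have heq := Finset.eq_of_subset_of_card_le hsub (le_of_eq hc.symm)
          have hb : b ∈ (Finset.univ.filter fun j => x j ≤ x a) := by
            rw [heq]; simp
          simp only [Finset.mem_filter, Finset.mem_univ, true_and] at hb
          exact hx (le_antisymm hab hb)
        rcases le_total (x i) (x i') with hle | hle
        · exact key i i' hle hcard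
        · exact (key i' i hle hcard.symm).symm)
  else 1

/-- The set of compatible rankings `C(r*, M)` associated to an incomplete ranking:
here the subset `M = {i₁ < ⋯ < iₘ} ⊆ {1,…,n}` is encoded by its strictly increasing
enumeration `ι : Fin m → Fin n`, and `C(r*, M)` consists of all complete rankings
`r ∈ Sₙ` such that `rank(r(i₁),…,r(iₘ)) = r*`. -/
noncomputable def compatibleRankings {n m : ℕ} (ι : Fin m → Fin n)
    (rstar : Equiv.Perm (Fin m)) : Set (Equiv.Perm (Fin n)) :=
  {r | rankPerm (fun ℓ => ((r (ι ℓ) : ℕ) : ℝ)) = rstar}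

theorem rankPerm_apply_val {n : ℕ} {x : Fin n → ℝ} (hx : Function.Injective x) (i : Fin n) :
    (rankPerm x i : ℕ) = #{j | x j ≤ x i} - 1 := by
  simp only [rankPerm, dif_pos hx, Equiv.ofBijective_apply]

theorem rankPerm_comp_perm {n : ℕ} {x : Fin n → ℝ} (hx : Function.Injective x)
    (σ : Equiv.Perm (Fin n)) : rankPerm (x ∘ σ) = rankPerm x * σ := by
  ext i
  rw [Equiv.Perm.mul_apply, rankPerm_apply_val (hx.comp σ.injective), rankPerm_apply_val hx]
  congr 1
  exact Finset.card_equiv σ (by simp)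

theorem rankPerm_of_strictMono {n : ℕ} {x : Fin n → ℝ} (hx : StrictMono x) :
    rankPerm x = 1 := by
  ext i
  rw [rankPerm_apply_val hx.injective]
  simp only [hx.le_iff_le, Finset.filter_ge_eq_Iic, Fin.card_Iic, Equiv.Perm.one_apply,
    Nat.add_sub_cancel]

/-- Two injective enumerations of the same set differ by a permutation of the indices. -/
theorem exists_perm_of_range_eq {α β : Type*} {f g : α → β} (hf : Function.Injective f)
    (hg : Function.Injective g) (h : Set.range f = Set.range g) :
    ∃ σ : Equiv.Perm α, f ∘ σ = g := by
  refine ⟨(Equiv.ofInjective g hg).trans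
    ((Equiv.setCongr h.symm).trans (Equiv.ofInjective f hf).symm), ?_⟩
  ext a
  simp [Equiv.apply_ofInjective_symm]

/-- Let `1 ≤ m < n`, let `M = {i₁ < ⋯ < iₘ} ⊆ {1,…,n}` (encoded by its increasing
enumeration `ι`), let `r_x, r_y ∈ Sₙ` and `r_y* ∈ Sₘ`, and set
`r_x* = rank(r_x(i₁),…,r_x(iₘ))`, `s* = r_y* ∘ (r_x*)⁻¹` and
`M* = {r_x(i₁),…,r_x(iₘ)}` (encoded by its increasing enumeration `ι*`).
Then `r_y ∈ C(r_y*, M)` if and only if `r_y ∘ r_x⁻¹ ∈ C(s*, M*)`. -/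
theorem mem_compatible_iff_transformed {n m : ℕ} (hm : 1 ≤ m) (hmn : m < n)
    (ι : Fin m → Fin n) (hι : StrictMono ι)
    (rx ry : Equiv.Perm (Fin n)) (rystar : Equiv.Perm (Fin m))
    (ιstar : Fin m → Fin n) (hιstar : StrictMono ιstar)
    (hrange : Set.range ιstar = rx '' Set.range ι) :
    ry ∈ compatibleRankings ι rystar ↔
      ry * rx⁻¹ ∈ compatibleRankings ιstar
        (rystar * (rankPerm fun ℓ => ((rx (ι ℓ) : ℕ) : ℝ))⁻¹) := by
  obtain ⟨σ, hσ⟩ := exists_perm_of_range_eq hιstar.injective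
    (rx.injective.comp hι.injective) (hrange.trans (Set.range_comp _ _).symm)
  have hσ_apply (ℓ : Fin m) : rx (ι ℓ) = ιstar (σ ℓ) := (congrFun hσ ℓ).symm
  have hval : StrictMono fun k : Fin n => ((k : ℕ) : ℝ) := fun _ _ hab =>
    Nat.cast_lt.mpr hab
  have hrx : (rankPerm fun ℓ => ((rx (ι ℓ) : ℕ) : ℝ)) = σ := by
    simp only [hσ_apply]
    have hmono := hval.comp hιstar
    exact (rankPerm_comp_perm hmono.injective σ).trans
      (by rw [rankPerm_of_strictMono hmono, one_mul])
  have hry : (rankPerm fun ℓ => ((ry (ι ℓ) : ℕ) : ℝ)) =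
      (rankPerm fun ℓ => (((ry * rx⁻¹) (ιstar ℓ) : ℕ) : ℝ)) * σ := by
    have hinj : Function.Injective fun ℓ => (((ry * rx⁻¹) (ιstar ℓ) : ℕ) : ℝ) :=
      hval.injective.comp ((ry * rx⁻¹).injective.comp hιstar.injective)
    rw [← rankPerm_comp_perm hinj σ]
    congr 1
    ext ℓ
    simp [← hσ_apply]
  simp only [compatibleRankings, Set.mem_ofPred_eq, hrx, hry, eq_mul_inv_iff_mul_eq]
end

section
/- Let the coefficients c_j(s), s ∈ S_n, j = 0,…,n−1, of the FGM rank likelihood be defined by c_0(s) = 1/n! and c_j(s) = n! Σ_{1 ≤ i_1 < ⋯ < i_j ≤ n} d_j(i_1,…,i_j) d_j(s(i_1),…,s(i_j)), with d_j(i_1,…,i_j) = (1/(n+j)!) Σ_{k_1=1}^{n+1} ⋯ Σ_{k_j=1}^{n+1} (−1)^{Σ_ℓ 1(k_ℓ > i_ℓ)} ∏_{p=1}^{n+1} (Σ_ℓ 1(k_ℓ = p))!. Then for every s ∈ S_n and every j, c_j(a ∘ s) = c_j(s) if j is even and c_j(a ∘ s) = −c_j(s) if j is odd, where a = (n, n−1,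 …, 1) is the anti-identity permutation. -/
open Finset

open scoped ENNReal

/-- The Farlie--Gumbel--Morgenstern copula density with parameter `θ ∈ [−1,1]`,
`c_θ(u,v) = 1 + θ(1−2u)(1−2v)` on `[0,1]²` (and `0` outside), as a density on `ℝ²`. -/
noncomputable def fgmDensity (θ : ℝ) : ℝ × ℝ → ℝ≥0∞ :=
  (Set.Icc (0 : ℝ) 1 ×ˢ Set.Icc (0 : ℝ) 1).indicator
    fun p => ENNReal.ofReal (1 + θ * (1 - 2 * p.1) * (1 - 2 * p.2))

/-- The quantity `d_j(i₁,…,i_j)` appearing in the coefficients of the polynomial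
expansion of the FGM rank likelihood: here the tuple `(i₁,…,i_j)` (with values in
`{1,…,n}`) is given as a function `i : Fin j → ℕ`, and the summation indices
`k₁,…,k_j ∈ {1,…,n+1}` are encoded as `k : Fin j → Fin (n+1)` via `k_ℓ = k ℓ + 1`. -/
noncomputable def fgmD (n j : ℕ) (i : Fin j → ℕ) : ℝ :=
  (Nat.factorial (n + j) : ℝ)⁻¹ *
    ∑ k : Fin j → Fin (n + 1),
      (-1 : ℝ) ^ (Finset.univ.filter fun ℓ => i ℓ < (k ℓ : ℕ) + 1).card *
        ∏ p ∈ Finset.Icc 1 (n + 1),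
          (Nat.factorial (Finset.univ.filter fun ℓ => (k ℓ : ℕ) + 1 = p).card : ℝ)

open Classical in
/-- The coefficient `c_j(s)` of `θ^j` in the polynomial expansion of the FGM rank
likelihood: `c₀(s) = 1/n!` and, for `j ≥ 1`,
`c_j(s) = n! ∑_{1 ≤ i₁ < ⋯ < i_j ≤ n} d_j(i₁,…,i_j) d_j(s(i₁),…,s(i_j))`.
Increasing tuples `1 ≤ i₁ < ⋯ < i_j ≤ n` are encoded as strictly monotone functions
`i : Fin j → Fin n` via `i_ℓ = i ℓ + 1`. -/
noncomputable def fgmCoeff (n : ℕ) (s : Equiv.Perm (Fin n)) (j : ℕ) : ℝ :=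
  if j = 0 then (Nat.factorial n : ℝ)⁻¹
  else
    (Nat.factorial n : ℝ) *
      ∑ i : Fin j → Fin n,
        if StrictMono i then
          fgmD n j (fun ℓ => (i ℓ : ℕ) + 1) * fgmD n j (fun ℓ => (s (i ℓ) : ℕ) + 1)
        else 0

/-- Reflecting all summation indices leaves the product of multiplicity factorials unchanged. -/
lemma prod_factorial_card_rev (n j : ℕ) (k : Fin j → Fin (n + 1)) :
    ∏ p ∈ Finset.Icc 1 (n + 1),
        (Nat.factorial (Finset.univ.filter fun ℓ => ((k ℓ).rev : ℕ) + 1 = p).card : ℝ)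
      = ∏ p ∈ Finset.Icc 1 (n + 1),
        (Nat.factorial (Finset.univ.filter fun ℓ => (k ℓ : ℕ) + 1 = p).card : ℝ) := by
  refine Finset.prod_nbij' (fun p => n + 2 - p) (fun p => n + 2 - p) ?_ ?_ ?_ ?_ ?_
  · intro p hp
    simp only [Finset.mem_Icc] at hp ⊢
    omega
  · intro p hp
    simp only [Finset.mem_Icc] at hp ⊢
    omega
  · intro p hp
    simp only [Finset.mem_Icc] at hp
    omega
  · intro p hp
    simp only [Finset.mem_Icc] at hp
    omega
  · intro p hp
    simp only [Finset.mem_Icc] at hp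
    congr 3
    ext ℓ
    have := (k ℓ).isLt
    simp only [Finset.mem_filter, Finset.mem_univ, true_and, Fin.val_rev]
    omega

/-- Reflecting both tuples complements the set of indices where `i` lies below `k`, so the
sign changes by `(-1) ^ j`. -/
lemma neg_one_pow_card_rev (n j : ℕ) (i : Fin j → Fin n) (k : Fin j → Fin (n + 1)) :
    (-1 : ℝ) ^ (Finset.univ.filter fun ℓ =>
        ((i ℓ).rev : ℕ) + 1 < ((k ℓ).rev : ℕ) + 1).card
      = (-1) ^ j * (-1) ^ (Finset.univ.filter fun ℓ => (i ℓ : ℕ) + 1 < (k ℓ : ℕ) + 1).card := by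
  have hfilter : (Finset.univ.filter fun ℓ => ((i ℓ).rev : ℕ) + 1 < ((k ℓ).rev : ℕ) + 1)
      = Finset.univ.filter fun ℓ => ¬ (i ℓ : ℕ) + 1 < (k ℓ : ℕ) + 1 := by
    ext ℓ
    have := (k ℓ).isLt
    have := (i ℓ).isLt
    simp only [Finset.mem_filter, Finset.mem_univ, true_and, Fin.val_rev]
    omega
  have hcard := Finset.card_filter_add_card_filter_not (s := (Finset.univ : Finset (Fin j)))
    (fun ℓ => (i ℓ : ℕ) + 1 < (k ℓ : ℕ) + 1)
  rw [Finset.card_univ, Fintype.card_fin] at hcard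
  rw [hfilter]
  have hpow := congrArg (fun m => (-1 : ℝ) ^ m) hcard
  simp only [pow_add] at hpow
  rw [← hpow, mul_right_comm, ← mul_pow, neg_one_mul, neg_neg, one_pow, one_mul]

/-- Reflecting the arguments multiplies `d_j` by `(-1) ^ j`. -/
lemma fgmD_rev (n j : ℕ) (i : Fin j → Fin n) :
    fgmD n j (fun ℓ => ((i ℓ).rev : ℕ) + 1)
      = (-1) ^ j * fgmD n j (fun ℓ => (i ℓ : ℕ) + 1) := by
  unfold fgmD
  rw [mul_left_comm, Finset.mul_sum _ _ ((-1 : ℝ) ^ j),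
    ← Equiv.sum_comp (Equiv.piCongrRight fun _ : Fin j => (Fin.revPerm : Equiv.Perm (Fin (n + 1))))]
  congr 1
  refine Finset.sum_congr rfl fun k _ => ?_
  simp only [Equiv.piCongrRight_apply, Pi.map_apply, Fin.revPerm_apply]
  rw [neg_one_pow_card_rev, prod_factorial_card_rev, mul_assoc]

/-- Composing with the anti-identity multiplies `c_j` by `(-1) ^ j`. -/
lemma fgmCoeff_revPerm_mul (n : ℕ) (s : Equiv.Perm (Fin n)) (j : ℕ) :
    fgmCoeff n ((Fin.revPerm : Equiv.Perm (Fin n)) * s) j = (-1) ^ j * fgmCoeff n s j := by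
  unfold fgmCoeff
  split_ifs with hj
  · simp [hj]
  · rw [mul_left_comm, Finset.mul_sum _ _ ((-1 : ℝ) ^ j)]
    congr 1
    refine Finset.sum_congr rfl fun i _ => ?_
    split_ifs
    · simp only [Equiv.Perm.mul_apply, Fin.revPerm_apply]
      rw [fgmD_rev n j fun ℓ => s (i ℓ), mul_left_comm]
    · simp

/-- The coefficients of the FGM rank likelihood expansion satisfy
`c_j(a ∘ s) = c_j(s)` if `j` is even and `c_j(a ∘ s) = −c_j(s)` if `j` is odd, where
`a = (n, n−1, …, 1)` is the anti-identity permutation. -/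
theorem fgmCoeff_antiIdentity_mul (n : ℕ) (s : Equiv.Perm (Fin n)) (j : ℕ)
    (hj : j < n) :
    (Even j → fgmCoeff n ((Fin.revPerm : Equiv.Perm (Fin n)) * s) j = fgmCoeff n s j)
      ∧ (Odd j → fgmCoeff n ((Fin.revPerm : Equiv.Perm (Fin n)) * s) j
          = -fgmCoeff n s j) := by
  rw [fgmCoeff_revPerm_mul]
  exact ⟨fun h => by rw [h.neg_one_pow, one_mul], fun h => by rw [h.neg_one_pow, neg_one_mul]⟩
end

section
/- Let the coefficients c_j(s), s ∈ S_n, j = 0,…,n−1, of the FGM rank likelihood be defined by c_0(s) = 1/n! and c_j(s) = n! Σ_{1 ≤ i_1 < ⋯ < i_j ≤ n} d_j(i_1,…,i_j) d_j(s(i_1),…,s(i_j)), with d_j(i_1,…,i_j) = (1/(n+j)!) Σ_{k_1=1}^{n+1} ⋯ Σ_{k_j=1}^{n+1} (−1)^{Σ_ℓ 1(k_ℓ > i_ℓ)} ∏_{p=1}^{n+1} (Σ_ℓ 1(k_ℓ = p))!. Then for every s ∈ S_n and every j = 0,…,n−1, |c_j(s)| ≤ c_j(e), where e is the identity permutation;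 in particular c_j(e) ≥ 0. -/
open Finset

open scoped ENNReal

/-- `fgmD` is a symmetric function of its arguments. -/
theorem fgmD_comp_perm (n j : ℕ) (i : Fin j → ℕ) (σ : Equiv.Perm (Fin j)) :
    fgmD n j (i ∘ σ) = fgmD n j i := by
  have hcard (P : Fin j → Prop) [DecidablePred P] :
      (Finset.univ.filter fun ℓ => P (σ ℓ)).card = (Finset.univ.filter P).card :=
    Finset.card_equiv σ (by simp)
  unfold fgmD
  congr 1
  refine (Fintype.sum_equiv (σ.arrowCongr (Equiv.refl (Fin (n + 1)))).symm _ _ fun k => ?_).symm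
  simp only [Equiv.arrowCongr_symm, Equiv.refl_symm, Equiv.arrowCongr_apply, Equiv.symm_symm,
    Equiv.coe_refl, Function.comp_apply, id_eq]
  rw [hcard fun ℓ => i ℓ < (k ℓ : ℕ) + 1]
  congr 1
  refine Finset.prod_congr rfl fun p _ => ?_
  rw [hcard fun ℓ => (k ℓ : ℕ) + 1 = p]

open Classical in
/-- Applying an injection to the entries of increasing tuples does not increase the sum of a
nonnegative symmetric function over them. -/
theorem sum_strictMono_comp_le {α : Type*} [LinearOrder α] [Fintype α] {j : ℕ}
    (g : (Fin j → α) → ℝ) (hg : ∀ i, 0 ≤ g i)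
    (hsymm : ∀ i (σ : Equiv.Perm (Fin j)), g (i ∘ σ) = g i)
    {s : α → α} (hs : Function.Injective s) :
    ∑ i : Fin j → α with StrictMono i, g (s ∘ i) ≤ ∑ i : Fin j → α with StrictMono i, g i := by
  let F : (Fin j → α) → Fin j → α := fun i => (s ∘ i) ∘ Tuple.sort (s ∘ i)
  have hrange (i : Fin j → α) : Set.range (F i) = s '' Set.range i := by
    rw [(Tuple.sort (s ∘ i)).surjective.range_comp, Set.range_comp]
  have hF : Set.InjOn F (Finset.univ.filter StrictMono : Finset (Fin j → α)) := by
    intro a ha b hb hab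
    simp only [Finset.coe_filter, Finset.mem_univ, true_and, Set.mem_ofPred_eq] at ha hb
    have h := congrArg Set.range hab
    rw [hrange, hrange] at h
    exact (StrictMono.range_inj ha hb).1 (hs.image_injective h)
  calc ∑ i : Fin j → α with StrictMono i, g (s ∘ i)
      = ∑ i : Fin j → α with StrictMono i, g (F i) :=
        Finset.sum_congr rfl fun i _ => (hsymm _ _).symm
    _ = ∑ i ∈ (Finset.univ.filter StrictMono).image F, g i := (Finset.sum_image hF).symm
    _ ≤ _ := by
        refine Finset.sum_le_sum_of_subset_of_nonneg ?_ fun i _ _ => hg i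
        intro f hf
        simp only [Finset.mem_image, Finset.mem_filter, Finset.mem_univ, true_and] at hf ⊢
        obtain ⟨i, hi, rfl⟩ := hf
        exact (Tuple.monotone_sort (s ∘ i)).strictMono_of_injective
          ((hs.comp hi.injective).comp (Equiv.injective _))

/-- The coefficients of the FGM rank likelihood expansion satisfy `|c_j(s)| ≤ c_j(e)`
for every `s ∈ Sₙ` and every `j = 0,…,n−1`, where `e` is the identity permutation;
in particular `c_j(e) ≥ 0`. -/
theorem abs_fgmCoeff_le_fgmCoeff_one (n : ℕ) (j : ℕ) (hj : j < n) :
    (∀ s : Equiv.Perm (Fin n), |fgmCoeff n s j| ≤ fgmCoeff n 1 j)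
      ∧ 0 ≤ fgmCoeff n 1 j := by
  suffices h : ∀ s : Equiv.Perm (Fin n), |fgmCoeff n s j| ≤ fgmCoeff n 1 j from
    ⟨h, (abs_nonneg _).trans (h 1)⟩
  classical
  intro s
  unfold fgmCoeff
  split_ifs with h0
  · rw [abs_of_nonneg (by positivity)]
  rw [abs_mul, abs_of_nonneg (by positivity : (0 : ℝ) ≤ (Nat.factorial n : ℝ))]
  refine mul_le_mul_of_nonneg_left ?_ (by positivity)
  let g : (Fin j → Fin n) → ℝ := fun i => fgmD n j fun ℓ => (i ℓ : ℕ) + 1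
  have hsq : ∑ i : Fin j → Fin n with StrictMono i, g (s ∘ i) ^ 2
      ≤ ∑ i : Fin j → Fin n with StrictMono i, g i ^ 2 := by
    refine sum_strictMono_comp_le (fun i => g i ^ 2) (fun i => sq_nonneg _) (fun i σ => ?_)
      s.injective
    exact congrArg (· ^ 2) (fgmD_comp_perm n j (fun ℓ => (i ℓ : ℕ) + 1) σ)
  simp only [← Finset.sum_filter, Equiv.Perm.one_apply]
  change |∑ i : Fin j → Fin n with StrictMono i, g i * g (s ∘ i)|
    ≤ ∑ i : Fin j → Fin n with StrictMono i, g i * g i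
  calc |∑ i : Fin j → Fin n with StrictMono i, g i * g (s ∘ i)|
      ≤ ∑ i : Fin j → Fin n with StrictMono i, |g i * g (s ∘ i)| :=
        Finset.abs_sum_le_sum_abs _ _
    _ ≤ ∑ i : Fin j → Fin n with StrictMono i, (g i ^ 2 + g (s ∘ i) ^ 2) / 2 := by
        refine Finset.sum_le_sum fun i _ => ?_
        rw [abs_le]
        constructor <;> nlinarith [sq_nonneg (g i + g (s ∘ i)), sq_nonneg (g i - g (s ∘ i))]
    _ ≤ ∑ i : Fin j → Fin n with StrictMono i, g i ^ 2 := by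
        rw [← Finset.sum_div, Finset.sum_add_distrib]
        linarith
    _ = _ := by simp only [sq]
end

section
/- Let π be a probability density on [−1,1] and define the marginal distribution P(S = s) = ∫_{−1}^{1} P_θ(S = s) π(θ) dθ, where P_θ(S = s) is the FGM rank likelihood. (i) If E_π(θ^{2k+1}) ≥ 0 for all k = 0,…,⌊n/2⌋ − 1, then the identity permutation e maximizes s ↦ P(S = s) over S_n. (ii) If E_π(θ^{2k+1}) ≤ 0 for all k = 0,…,⌊n/2⌋ − 1, then the anti-identity a = (n, n−1, …, 1) maximizes s ↦ P(S = s) over S_n. -/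
open Finset

open scoped ENNReal

open MeasureTheory

/-- The FGM rank likelihood `P_θ(S = s)`: the probability that
`S = rank(V) ∘ rank(U)⁻¹ = s` when `(Uᵢ, Vᵢ)`, `i = 1,…,n`, are i.i.d. with joint
density `c_θ` on `[0,1]²`, realized on the canonical product space. -/
noncomputable def fgmRankLik (n : ℕ) (θ : ℝ) (s : Equiv.Perm (Fin n)) : ℝ :=
  ((Measure.pi fun _ : Fin n => volume.withDensity (fgmDensity θ))
    {ω : Fin n → ℝ × ℝ |
      rankPerm (fun i => (ω i).2) * (rankPerm (fun i => (ω i).1))⁻¹ = s}).toReal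

/-- The uniform distribution on `[0,1]`. -/
noncomputable def unitMeasure : Measure ℝ := volume.restrict (Set.Icc 0 1)

instance : IsProbabilityMeasure unitMeasure :=
  ⟨by simp [unitMeasure]⟩

/-- The vectors whose coordinates are ordered in the same way as the values of `σ`. -/
def rankRegion {n : ℕ} (σ : Equiv.Perm (Fin n)) : Set (Fin n → ℝ) :=
  {x | ∀ i j, x i < x j ↔ σ i < σ j}

lemma measurableSet_rankRegion {n : ℕ} (σ : Equiv.Perm (Fin n)) :
    MeasurableSet (rankRegion σ) := by
  have h : rankRegion σ = ⋂ i, ⋂ j, {x : Fin n → ℝ | x i < x j ↔ σ i < σ j} := by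
    ext x; simp [rankRegion]
  rw [h]
  refine MeasurableSet.iInter fun i => MeasurableSet.iInter fun j => ?_
  exact (measurableSet_lt (measurable_pi_apply i) (measurable_pi_apply j)).iff
    (MeasurableSet.const _)

lemma Equiv.Perm.eq_of_lt_iff_lt {n : ℕ} {σ τ : Equiv.Perm (Fin n)}
    (h : ∀ i j, σ i < σ j ↔ τ i < τ j) : σ = τ := by
  have hσ : StrictMono fun i => τ (σ.symm i) := fun a b hab => by
    rw [← h]; simpa using hab
  have hid := (hσ.range_inj strictMono_id).1
    ((τ.surjective.comp σ.symm.surjective).range_eq.trans Set.range_id.symm)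
  refine Equiv.ext fun i => ?_
  simpa using (congrFun hid (σ i)).symm

lemma rankPerm_lt_iff {n : ℕ} {x : Fin n → ℝ} (hx : Function.Injective x) (i j : Fin n) :
    rankPerm x i < rankPerm x j ↔ x i < x j := by
  classical
  have key : ∀ a b, x a < x b → rankPerm x a < rankPerm x b := by
    intro a b hab
    have hpos : 0 < (Finset.univ.filter fun j => x j ≤ x a).card :=
      Finset.card_pos.mpr ⟨a, by simp⟩
    have hlt : (Finset.univ.filter fun j => x j ≤ x a).card
        < (Finset.univ.filter fun j => x j ≤ x b).card := by
      refine Finset.card_lt_card (Finset.ssubset_iff_of_subset ?_ |>.2 ⟨b, by simp, by simpa⟩)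
      intro j
      simp only [Finset.mem_filter, Finset.mem_univ, true_and]
      exact fun hj => hj.trans hab.le
    simp only [rankPerm, hx, dif_pos, Equiv.ofBijective_apply, Fin.mk_lt_mk]
    convert Nat.sub_lt_sub_right hpos hlt
  refine ⟨fun h => ?_, key i j⟩
  rcases lt_trichotomy (x i) (x j) with hlt | heq | hgt
  · exact hlt
  · exact absurd (hx heq ▸ h) (lt_irrefl _)
  · exact absurd (key j i hgt) h.asymm

lemma rankPerm_eq_iff {n : ℕ} {x : Fin n → ℝ} (hx : Function.Injective x)
    (σ : Equiv.Perm (Fin n)) : rankPerm x = σ ↔ x ∈ rankRegion σ := by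
  constructor
  · rintro rfl i j
    exact (rankPerm_lt_iff hx i j).symm
  · intro h
    exact Equiv.Perm.eq_of_lt_iff_lt fun i j => (rankPerm_lt_iff hx i j).trans (h i j)

lemma disjoint_rankRegion {n : ℕ} {σ τ : Equiv.Perm (Fin n)} (h : σ ≠ τ) :
    Disjoint (rankRegion σ) (rankRegion τ) :=
  Set.disjoint_left.2 fun _ h₁ h₂ =>
    h (Equiv.Perm.eq_of_lt_iff_lt fun i j => (h₁ i j).symm.trans (h₂ i j))

lemma ae_injective_pi_unitMeasure (n : ℕ) :
    ∀ᵐ x ∂Measure.pi fun _ : Fin n => unitMeasure, Function.Injective x := by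
  have hvol : ∀ᵐ x : Fin n → ℝ, Function.Injective x := by
    have h : ∀ i j : Fin n, ∀ᵐ x : Fin n → ℝ, x i = x j → i = j := by
      intro i j
      by_cases hij : i = j
      · simp [hij]
      have hnull := Measure.addHaar_submodule (volume : Measure (Fin n → ℝ))
        (LinearMap.ker (LinearMap.proj (R := ℝ) (φ := fun _ : Fin n => ℝ) i
          - LinearMap.proj j)) (by
            intro htop
            have hmem : Pi.single i (1 : ℝ) ∈ LinearMap.ker
                (LinearMap.proj (R := ℝ) (φ := fun _ : Fin n => ℝ) i - LinearMap.proj j) :=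
              htop ▸ Submodule.mem_top
            simp [Ne.symm hij] at hmem)
      refine measure_mono_null (fun x hx => ?_) hnull
      simp only [Set.mem_compl_iff, Set.mem_ofPred_eq, Classical.not_imp] at hx
      simp [hx.1]
    filter_upwards [ae_all_iff.2 fun i => ae_all_iff.2 (h i)] with x hx i j hij
    exact hx i j hij
  unfold unitMeasure
  rw [← Measure.restrict_pi_pi, ← volume_pi]
  exact ae_restrict_of_ae hvol

lemma measurePreserving_one_sub_unitMeasure :
    MeasurePreserving (fun x : ℝ => 1 - x) unitMeasure unitMeasure := by
  have h := (volume.measurePreserving_sub_left (1 : ℝ)).restrict_preimage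
    (s := Set.Icc (0 : ℝ) 1) measurableSet_Icc
  have hpre : (fun x : ℝ => 1 - x) ⁻¹' Set.Icc 0 1 = Set.Icc 0 1 := by
    ext x; simp
  rwa [hpre] at h

lemma measurable_prod_one_sub {n : ℕ} (A : Finset (Fin n)) :
    Measurable fun x : Fin n → ℝ => ∏ i ∈ A, (1 - 2 * x i) :=
  Finset.measurable_prod _ fun i _ => by fun_prop

/-- The integral of `∏ i ∈ A, (1 - 2 x i)` over the vectors of `[0,1]ⁿ` of rank `σ`. -/
noncomputable def rankMoment {n : ℕ} (σ : Equiv.Perm (Fin n)) (A : Finset (Fin n)) : ℝ :=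
  ∫ x in rankRegion σ, ∏ i ∈ A, (1 - 2 * x i) ∂Measure.pi fun _ => unitMeasure

lemma rankMoment_revPerm_mul {n : ℕ} (σ : Equiv.Perm (Fin n)) (A : Finset (Fin n)) :
    rankMoment (Fin.revPerm * σ) A = (-1) ^ A.card * rankMoment σ A := by
  have hmp := measurePreserving_pi (fun _ : Fin n => unitMeasure) (fun _ => unitMeasure)
    fun _ => measurePreserving_one_sub_unitMeasure
  have hpre : (fun (x : Fin n → ℝ) i => 1 - x i) ⁻¹' rankRegion (Fin.revPerm * σ)
      = rankRegion σ := by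
    ext x
    simp only [rankRegion, Set.mem_preimage, Set.mem_ofPred_eq, sub_lt_sub_iff_left,
      Equiv.Perm.mul_apply, Fin.revPerm_apply, Fin.rev_lt_rev]
    exact forall_comm
  unfold rankMoment
  rw [← hmp.map_eq, setIntegral_map (measurableSet_rankRegion _)
    (measurable_prod_one_sub A).aestronglyMeasurable hmp.measurable.aemeasurable, hpre,
    hmp.map_eq, ← integral_const_mul]
  refine integral_congr_ae (.of_forall fun x => ?_)
  simp only
  rw [← Finset.prod_const, ← Finset.prod_mul_distrib]
  exact Finset.prod_congr rfl fun i _ => by ring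

lemma rankMoment_mul_univ {n : ℕ} (σ ρ : Equiv.Perm (Fin n)) :
    rankMoment (σ * ρ) univ = rankMoment σ univ := by
  have hmp := measurePreserving_piCongrLeft (fun _ : Fin n => unitMeasure) ρ
  have hval : ∀ (x : Fin n → ℝ) i,
      MeasurableEquiv.piCongrLeft (fun _ => ℝ) ρ x (ρ i) = x i := fun x i => by
    exact Equiv.piCongrLeft_apply_apply (fun _ => ℝ) ρ x i
  have hpre : MeasurableEquiv.piCongrLeft (fun _ => ℝ) ρ ⁻¹' rankRegion σ
      = rankRegion (σ * ρ) := by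
    ext x
    simp only [rankRegion, Set.mem_preimage, Set.mem_ofPred_eq, Equiv.Perm.mul_apply]
    rw [← ρ.forall_congr_right]
    refine forall_congr' fun i => ?_
    rw [← ρ.forall_congr_right]
    simp only [hval]
  unfold rankMoment
  rw [← hpre]
  refine Eq.trans (integral_congr_ae (.of_forall fun x => ?_))
    (hmp.setIntegral_preimage_emb (MeasurableEquiv.measurableEmbedding _)
      (fun x => ∏ i, (1 - 2 * x i)) _)
  rw [← Equiv.prod_comp ρ]
  simp only [hval]

lemma rankMoment_univ_of_odd {n : ℕ} (hn : Odd n) (σ : Equiv.Perm (Fin n)) :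
    rankMoment σ univ = 0 := by
  have h₁ := rankMoment_revPerm_mul σ univ
  have h₂ := rankMoment_mul_univ σ (σ⁻¹ * Fin.revPerm * σ)
  rw [show σ * (σ⁻¹ * Fin.revPerm * σ) = Fin.revPerm * σ by group, h₁] at h₂
  simp only [card_univ, Fintype.card_fin, hn.neg_one_pow] at h₂
  linarith

open ProbabilityTheory in
lemma pi_withDensity_const {ι α : Type*} [Fintype ι] [MeasurableSpace α] (ν : Measure α)
    [IsProbabilityMeasure ν] {f : α → ℝ≥0∞} (hf : Measurable f)
    [SigmaFinite (ν.withDensity f)] :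
    (Measure.pi fun _ : ι => ν.withDensity f)
      = (Measure.pi fun _ : ι => ν).withDensity fun x => ∏ i, f (x i) := by
  refine Measure.pi_eq fun s hs => ?_
  have hms : MeasurableSet (Set.univ.pi s) := MeasurableSet.univ_pi hs
  have hmeas : ∀ i, Measurable ((s i).indicator f) := fun i => hf.indicator (hs i)
  rw [withDensity_apply _ hms, ← lintegral_indicator hms]
  have hprod : (Set.univ.pi s).indicator (fun x : ι → α => ∏ i, f (x i))
      = fun x => ∏ i, (s i).indicator f (x i) := by
    ext x
    by_cases hx : x ∈ Set.univ.pi s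
    · rw [Set.indicator_of_mem hx]
      exact prod_congr rfl fun i _ => (Set.indicator_of_mem (hx i trivial) f).symm
    · rw [Set.indicator_of_notMem hx]
      obtain ⟨i, hi⟩ : ∃ i, x i ∉ s i := by simpa [Set.mem_pi] using hx
      exact (prod_eq_zero (mem_univ i) (Set.indicator_of_notMem hi f)).symm
  rw [hprod, lintegral_prod_eq_prod_lintegral_of_indepFun _
    (fun i (x : ι → α) => (s i).indicator f (x i))
    (iIndepFun_pi fun i => (hmeas i).aemeasurable)
    fun i => (hmeas i).comp (measurable_pi_apply i)]
  refine prod_congr rfl fun i _ => ?_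
  rw [(measurePreserving_eval (fun _ : ι => ν) i).lintegral_comp (hmeas i),
    lintegral_indicator (hs i), withDensity_apply _ (hs i)]

/-- The part of `fgmDensity θ` inside the unit square, without truncation at `0`. -/
def fgmFactor (θ : ℝ) (p : ℝ × ℝ) : ℝ := 1 + θ * (1 - 2 * p.1) * (1 - 2 * p.2)

lemma fgmFactor_nonneg {θ : ℝ} (hθ : θ ∈ Set.Icc (-1 : ℝ) 1) {p : ℝ × ℝ}
    (hp : p ∈ Set.Icc (0 : ℝ) 1 ×ˢ Set.Icc (0 : ℝ) 1) : 0 ≤ fgmFactor θ p := by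
  obtain ⟨⟨h₁, h₂⟩, h₃, h₄⟩ := hp
  have hle : |θ * (1 - 2 * p.1) * (1 - 2 * p.2)| ≤ 1 := by
    rw [abs_mul, abs_mul]
    have ha : |θ| ≤ 1 := abs_le.2 hθ
    have hb : |1 - 2 * p.1| ≤ 1 := abs_le.2 ⟨by linarith, by linarith⟩
    have hc : |1 - 2 * p.2| ≤ 1 := abs_le.2 ⟨by linarith, by linarith⟩
    exact mul_le_one₀ (mul_le_one₀ ha (abs_nonneg _) hb) (abs_nonneg _) hc
  unfold fgmFactor
  linarith [neg_le_of_abs_le hle]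

lemma measurable_fgmFactor (θ : ℝ) : Measurable (fgmFactor θ) := by
  unfold fgmFactor; fun_prop

lemma withDensity_fgmDensity (θ : ℝ) :
    (volume : Measure (ℝ × ℝ)).withDensity (fgmDensity θ)
      = (unitMeasure.prod unitMeasure).withDensity fun p => ENNReal.ofReal (fgmFactor θ p) := by
  unfold fgmDensity unitMeasure
  rw [withDensity_indicator (measurableSet_Icc.prod measurableSet_Icc),
    Measure.prod_restrict, ← Measure.volume_eq_prod]
  rfl

lemma ae_pi_mem_square (n : ℕ) :
    ∀ᵐ ω ∂Measure.pi fun _ : Fin n => unitMeasure.prod unitMeasure,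
      ∀ i, ω i ∈ Set.Icc (0 : ℝ) 1 ×ˢ Set.Icc (0 : ℝ) 1 := by
  refine ae_all_iff.2 fun i => ?_
  refine (measurePreserving_eval (fun _ : Fin n => unitMeasure.prod unitMeasure)
    i).quasiMeasurePreserving.ae ?_
  unfold unitMeasure
  rw [Measure.prod_restrict]
  exact ae_restrict_mem (measurableSet_Icc.prod measurableSet_Icc)

/-- The samples whose first and second coordinates have ranks `σ` and `τ`. -/
def rankRectangle {n : ℕ} (σ τ : Equiv.Perm (Fin n)) : Set (Fin n → ℝ × ℝ) :=
  MeasurableEquiv.arrowProdEquivProdArrow ℝ ℝ (Fin n) ⁻¹' (rankRegion σ ×ˢ rankRegion τ)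

lemma measurableSet_rankRectangle {n : ℕ} (σ τ : Equiv.Perm (Fin n)) :
    MeasurableSet (rankRectangle σ τ) :=
  (MeasurableEquiv.measurable _)
    ((measurableSet_rankRegion σ).prod (measurableSet_rankRegion τ))

lemma rankEvent_ae_eq {n : ℕ} (s : Equiv.Perm (Fin n)) :
    {ω : Fin n → ℝ × ℝ |
      rankPerm (fun i => (ω i).2) * (rankPerm (fun i => (ω i).1))⁻¹ = s}
      =ᵐ[Measure.pi fun _ => unitMeasure.prod unitMeasure] ⋃ σ, rankRectangle σ (s * σ) := by
  have hmp := measurePreserving_arrowProdEquivProdArrow ℝ ℝ (Fin n)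
    (fun _ => unitMeasure) (fun _ => unitMeasure)
  have h₁ := hmp.quasiMeasurePreserving.ae
    (Measure.quasiMeasurePreserving_fst.ae (ae_injective_pi_unitMeasure n))
  have h₂ := hmp.quasiMeasurePreserving.ae
    (Measure.quasiMeasurePreserving_snd.ae (ae_injective_pi_unitMeasure n))
  filter_upwards [h₁, h₂] with ω hu hv
  change Function.Injective (fun i => (ω i).1) at hu
  change Function.Injective (fun i => (ω i).2) at hv
  refine propext (Iff.trans (b := rankPerm (fun i => (ω i).2)
    = s * rankPerm fun i => (ω i).1) mul_inv_eq_iff_eq_mul ?_)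
  change _ ↔ ω ∈ ⋃ σ, rankRectangle σ (s * σ)
  rw [Set.mem_iUnion]
  change _ ↔ ∃ σ, (fun i => (ω i).1) ∈ rankRegion σ ∧ (fun i => (ω i).2) ∈ rankRegion (s * σ)
  simp only [← rankPerm_eq_iff hu, ← rankPerm_eq_iff hv]
  simp

lemma ae_pi_abs_le_one (n : ℕ) : ∀ᵐ x ∂Measure.pi fun _ : Fin n => unitMeasure,
    ∀ i, |1 - 2 * x i| ≤ 1 := by
  refine ae_all_iff.2 fun i => ?_
  refine (measurePreserving_eval (fun _ : Fin n => unitMeasure)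
    i).quasiMeasurePreserving.ae (p := fun x => |1 - 2 * x| ≤ 1) ?_
  filter_upwards [ae_restrict_mem (μ := volume) (measurableSet_Icc (a := (0 : ℝ)) (b := 1))]
    with x hx
  exact abs_le.2 ⟨by linarith [hx.2], by linarith [hx.1]⟩

lemma integrable_prod_one_sub {n : ℕ} (A : Finset (Fin n)) :
    Integrable (fun x : Fin n → ℝ => ∏ i ∈ A, (1 - 2 * x i))
      (Measure.pi fun _ => unitMeasure) := by
  refine Integrable.of_bound (measurable_prod_one_sub A).aestronglyMeasurable 1 ?_
  filter_upwards [ae_pi_abs_le_one n] with x hx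
  rw [Real.norm_eq_abs, abs_prod]
  exact prod_le_one (fun _ _ => abs_nonneg _) fun i _ => hx i

lemma setIntegral_rankRectangle {n : ℕ} (θ : ℝ) (σ τ : Equiv.Perm (Fin n)) :
    IntegrableOn (fun ω => ∏ i, fgmFactor θ (ω i)) (rankRectangle σ τ)
        (Measure.pi fun _ => unitMeasure.prod unitMeasure) ∧
      ∫ ω in rankRectangle σ τ, ∏ i, fgmFactor θ (ω i)
          ∂Measure.pi (fun _ => unitMeasure.prod unitMeasure)
        = ∑ A : Finset (Fin n), θ ^ A.card * (rankMoment σ A * rankMoment τ A) := by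
  have hmp := measurePreserving_arrowProdEquivProdArrow ℝ ℝ (Fin n)
    (fun _ => unitMeasure) (fun _ => unitMeasure)
  have hemb := (MeasurableEquiv.arrowProdEquivProdArrow ℝ ℝ (Fin n)).measurableEmbedding
  let F : (Fin n → ℝ) × (Fin n → ℝ) → ℝ := fun z => ∑ A : Finset (Fin n), θ ^ A.card *
    ((∏ i ∈ A, (1 - 2 * z.1 i)) * ∏ i ∈ A, (1 - 2 * z.2 i))
  have hexp : (fun ω : Fin n → ℝ × ℝ => ∏ i, fgmFactor θ (ω i))
      = F ∘ MeasurableEquiv.arrowProdEquivProdArrow ℝ ℝ (Fin n) := by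
    ext ω
    simp only [fgmFactor, prod_one_add, powerset_univ, Function.comp_apply, F]
    refine sum_congr rfl fun A _ => ?_
    rw [prod_mul_distrib, prod_mul_distrib, prod_const, mul_assoc]
    rfl
  have hintegrable : ∀ A : Finset (Fin n), Integrable (fun z : (Fin n → ℝ) × (Fin n → ℝ) =>
      θ ^ A.card * ((∏ i ∈ A, (1 - 2 * z.1 i)) * ∏ i ∈ A, (1 - 2 * z.2 i)))
      ((Measure.pi fun _ => unitMeasure).prod (Measure.pi fun _ => unitMeasure)) := fun A =>
    ((integrable_prod_one_sub A).mul_prod (integrable_prod_one_sub A)).const_mul _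
  refine ⟨?_, ?_⟩
  · rw [hexp]
    exact ((hmp.integrable_comp_emb hemb).2 (integrable_finsetSum _ fun A _ => hintegrable A)).integrableOn
  · rw [hexp, rankRectangle]
    refine (hmp.setIntegral_preimage_emb hemb F _).trans ?_
    rw [integral_finsetSum _ fun A _ => (hintegrable A).integrableOn]
    refine sum_congr rfl fun A _ => ?_
    rw [integral_const_mul, setIntegral_prod_mul
      (fun x : Fin n → ℝ => ∏ i ∈ A, (1 - 2 * x i))
      (fun x : Fin n → ℝ => ∏ i ∈ A, (1 - 2 * x i))]
    rfl

/-- The contribution of the set `A` to the coefficient of `θ ^ #A` in the rank likelihood. -/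
noncomputable def rankCoeff {n : ℕ} (s : Equiv.Perm (Fin n)) (A : Finset (Fin n)) : ℝ :=
  ∑ σ, rankMoment σ A * rankMoment (s * σ) A

lemma fgmRankLik_eq_sum {n : ℕ} {θ : ℝ} (hθ : θ ∈ Set.Icc (-1 : ℝ) 1)
    (s : Equiv.Perm (Fin n)) :
    fgmRankLik n θ s = ∑ A : Finset (Fin n), θ ^ A.card * rankCoeff s A := by
  have hmeas : Measurable fun p => ENNReal.ofReal (fgmFactor θ p) :=
    (measurable_fgmFactor θ).ennreal_ofReal
  have hU : MeasurableSet (⋃ σ, rankRectangle σ (s * σ)) :=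
    MeasurableSet.iUnion fun σ => measurableSet_rankRectangle _ _
  unfold fgmRankLik
  have : SigmaFinite ((unitMeasure.prod unitMeasure).withDensity
      fun p => ENNReal.ofReal (fgmFactor θ p)) := SigmaFinite.withDensity_ofReal _
  rw [withDensity_fgmDensity, pi_withDensity_const _ hmeas,
    measure_congr ((withDensity_absolutelyContinuous _ _).ae_eq (rankEvent_ae_eq s)),
    withDensity_apply _ hU]
  have hae := ae_pi_mem_square n
  have hof : ∫⁻ ω in ⋃ σ, rankRectangle σ (s * σ), ∏ i, ENNReal.ofReal (fgmFactor θ (ω i))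
        ∂Measure.pi (fun _ => unitMeasure.prod unitMeasure)
      = ∫⁻ ω in ⋃ σ, rankRectangle σ (s * σ), ENNReal.ofReal (∏ i, fgmFactor θ (ω i))
        ∂Measure.pi (fun _ => unitMeasure.prod unitMeasure) := by
    refine lintegral_congr_ae (ae_restrict_of_ae ?_)
    filter_upwards [hae] with ω hω
    exact (ENNReal.ofReal_prod_of_nonneg fun i _ => fgmFactor_nonneg hθ (hω i)).symm
  rw [hof, ← integral_eq_lintegral_of_nonneg_ae]
  · rw [integral_iUnion_fintype (fun σ => measurableSet_rankRectangle _ _) ?_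
      fun σ => (setIntegral_rankRectangle θ σ (s * σ)).1]
    · simp only [(setIntegral_rankRectangle θ _ _).2, rankCoeff, mul_sum]
      exact sum_comm
    · intro σ τ h
      exact (Set.disjoint_prod.2 (.inl (disjoint_rankRegion h))).preimage _
  · refine ae_restrict_of_ae ?_
    filter_upwards [hae] with ω hω
    exact prod_nonneg fun i _ => fgmFactor_nonneg hθ (hω i)
  · exact (Finset.measurable_prod _ fun i _ =>
      (measurable_fgmFactor θ).comp (measurable_pi_apply i)).aestronglyMeasurable

lemma abs_rankCoeff_le {n : ℕ} (s : Equiv.Perm (Fin n)) (A : Finset (Fin n)) :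
    |rankCoeff s A| ≤ rankCoeff 1 A := by
  have hshift : ∑ σ, rankMoment (s * σ) A ^ 2 = ∑ σ, rankMoment σ A ^ 2 :=
    Equiv.sum_comp (Equiv.mulLeft s) fun σ => rankMoment σ A ^ 2
  calc |rankCoeff s A| ≤ ∑ σ, |rankMoment σ A * rankMoment (s * σ) A| := abs_sum_le_sum_abs _ _
    _ ≤ ∑ σ, (rankMoment σ A ^ 2 + rankMoment (s * σ) A ^ 2) / 2 := by
      refine sum_le_sum fun σ _ => abs_le.2 ⟨?_, ?_⟩
      · linarith [sq_nonneg (rankMoment σ A + rankMoment (s * σ) A)]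
      · linarith [sq_nonneg (rankMoment σ A - rankMoment (s * σ) A)]
    _ = rankCoeff 1 A := by
      rw [← sum_div, sum_add_distrib, hshift, add_self_div_two]
      simp [rankCoeff, sq]

lemma rankCoeff_revPerm {n : ℕ} (A : Finset (Fin n)) :
    rankCoeff Fin.revPerm A = (-1) ^ A.card * rankCoeff 1 A := by
  simp only [rankCoeff, rankMoment_revPerm_mul, mul_sum, one_mul]
  exact sum_congr rfl fun σ _ => by ring

lemma rankCoeff_univ_of_odd {n : ℕ} (hn : Odd n) (s : Equiv.Perm (Fin n)) :
    rankCoeff s univ = 0 := by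
  simp [rankCoeff, rankMoment_univ_of_odd hn]

lemma integral_fgmRankLik_mul {n : ℕ} {π : ℝ → ℝ}
    (hπ : IntegrableOn π (Set.Icc (-1 : ℝ) 1)) (s : Equiv.Perm (Fin n)) :
    ∫ θ in Set.Icc (-1 : ℝ) 1, fgmRankLik n θ s * π θ
      = ∑ A : Finset (Fin n), (∫ θ in Set.Icc (-1 : ℝ) 1, θ ^ A.card * π θ) * rankCoeff s A := by
  have hintegrable : ∀ k : ℕ, IntegrableOn (fun θ : ℝ => θ ^ k * π θ) (Set.Icc (-1 : ℝ) 1) := fun k =>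
    hπ.continuousOn_mul (by fun_prop) isCompact_Icc
  simp only [← integral_mul_const]
  rw [← integral_finsetSum _ fun A _ => (hintegrable A.card).mul_const _]
  refine setIntegral_congr_fun measurableSet_Icc fun θ hθ => ?_
  simp only [fgmRankLik_eq_sum hθ, sum_mul]
  exact sum_congr rfl fun A _ => by ring

/-- An odd size of a set with nonzero contribution is of the form `2k+1` with `k < n / 2`. -/
lemma exists_lt_half_of_odd_card {n : ℕ} {s : Equiv.Perm (Fin n)} {A : Finset (Fin n)}
    (hA : Odd A.card) (hs : rankCoeff s A ≠ 0) : ∃ k < n / 2, A.card = 2 * k + 1 := by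
  obtain ⟨k, hk⟩ := hA
  refine ⟨k, ?_, hk⟩
  have hle : A.card ≤ n := by simpa using card_le_univ A
  rcases hle.eq_or_lt with heq | hlt
  · have huniv : A = univ := (card_eq_iff_eq_univ A).1 (by simpa using heq)
    exact absurd (huniv ▸ rankCoeff_univ_of_odd (heq ▸ ⟨k, hk⟩) s) hs
  · omega

/-- Let `π` be a probability density on `[−1,1]` and define the marginal distribution
`P(S = s) = ∫_{−1}^{1} P_θ(S = s) π(θ) dθ`.  (i) If all the odd moments
`E_π(θ^{2k+1})`, `k = 0,…,⌊n/2⌋−1`, are nonnegative, then the identity permutation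
maximizes `s ↦ P(S = s)`; (ii) if they are all nonpositive, then the anti-identity
maximizes it. -/
theorem fgm_marginal_mode (n : ℕ) (π : ℝ → ℝ)
    (hπ0 : ∀ θ : ℝ, θ ∉ Set.Icc (-1 : ℝ) 1 → π θ = 0)
    (hπnonneg : ∀ θ : ℝ, 0 ≤ π θ)
    (hπint : MeasureTheory.IntegrableOn π (Set.Icc (-1 : ℝ) 1))
    (hπ1 : ∫ θ in Set.Icc (-1 : ℝ) 1, π θ = 1) :
    ((∀ k : ℕ, k < n / 2 →
        0 ≤ ∫ θ in Set.Icc (-1 : ℝ) 1, θ ^ (2 * k + 1) * π θ) →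
      ∀ s : Equiv.Perm (Fin n),
        ∫ θ in Set.Icc (-1 : ℝ) 1, fgmRankLik n θ s * π θ
          ≤ ∫ θ in Set.Icc (-1 : ℝ) 1, fgmRankLik n θ 1 * π θ)
    ∧ ((∀ k : ℕ, k < n / 2 →
        (∫ θ in Set.Icc (-1 : ℝ) 1, θ ^ (2 * k + 1) * π θ) ≤ 0) →
      ∀ s : Equiv.Perm (Fin n),
        ∫ θ in Set.Icc (-1 : ℝ) 1, fgmRankLik n θ s * π θ
          ≤ ∫ θ in Set.Icc (-1 : ℝ) 1,
              fgmRankLik n θ (Fin.revPerm : Equiv.Perm (Fin n)) * π θ) := by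
  have heven : ∀ k : ℕ, Even k → 0 ≤ ∫ θ in Set.Icc (-1 : ℝ) 1, θ ^ k * π θ := fun k hk =>
    integral_nonneg fun θ => mul_nonneg (hk.pow_nonneg θ) (hπnonneg θ)
  refine ⟨fun hodd s => ?_, fun hodd s => ?_⟩
  · rw [integral_fgmRankLik_mul hπint, integral_fgmRankLik_mul hπint]
    refine sum_le_sum fun A _ => ?_
    have habs := abs_rankCoeff_le s A
    rcases Nat.even_or_odd A.card with hA | hA
    · exact mul_le_mul_of_nonneg_left (le_of_abs_le habs) (heven _ hA)
    · by_cases h1 : rankCoeff 1 A = 0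
      · rw [h1, abs_nonpos_iff.1 (habs.trans_eq h1)]
      · obtain ⟨k, hk, hcard⟩ := exists_lt_half_of_odd_card hA h1
        exact mul_le_mul_of_nonneg_left (le_of_abs_le habs) (hcard ▸ hodd k hk)
  · rw [integral_fgmRankLik_mul hπint, integral_fgmRankLik_mul hπint]
    refine sum_le_sum fun A _ => ?_
    have habs := abs_rankCoeff_le s A
    rw [rankCoeff_revPerm]
    rcases Nat.even_or_odd A.card with hA | hA
    · rw [hA.neg_one_pow, one_mul]
      exact mul_le_mul_of_nonneg_left (le_of_abs_le habs) (heven _ hA)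
    · rw [hA.neg_one_pow, neg_one_mul]
      by_cases h1 : rankCoeff 1 A = 0
      · rw [h1, abs_nonpos_iff.1 (habs.trans_eq h1), neg_zero]
      · obtain ⟨k, hk, hcard⟩ := exists_lt_half_of_odd_card hA h1
        exact mul_le_mul_of_nonpos_left (neg_le_of_abs_le habs) (hcard ▸ hodd k hk)
end

section
/- Let α > 0, β > 0, let T have the Beta(α, β) distribution and set θ = 2T − 1. Then for every odd positive integer k: E(θ^k) ≥ 0 if α ≥ β, and E(θ^k) ≤ 0 if α ≤ β. -/
open MeasureTheory

/-- A function on `(0,1)` whose symmetrization about `1/2` is nonnegative has nonnegative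
integral; no integrability is needed, since the integral is `0` otherwise. -/
theorem setIntegral_Ioo_nonneg_of_add_reflect_nonneg {f : ℝ → ℝ}
    (hf : ∀ t ∈ Set.Ioo (0 : ℝ) 1, 0 ≤ f t + f (1 - t)) :
    0 ≤ ∫ t in Set.Ioo (0 : ℝ) 1, f t := by
  rw [← integral_Ioc_eq_integral_Ioo, ← intervalIntegral.integral_of_le zero_le_one]
  by_cases hi : IntervalIntegrable f volume 0 1
  · have hi' : IntervalIntegrable (fun t => f (1 - t)) volume 0 1 := by
      simpa using (hi.comp_sub_left 1).symm
    have hsum : ∫ t in (0 : ℝ)..1, (f t + f (1 - t)) = 2 * ∫ t in (0 : ℝ)..1, f t := by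
      rw [intervalIntegral.integral_add hi hi', intervalIntegral.integral_comp_sub_left]
      simp [two_mul]
    have hnonneg : 0 ≤ ∫ t in (0 : ℝ)..1, (f t + f (1 - t)) := by
      rw [intervalIntegral.integral_of_le zero_le_one, integral_Ioc_eq_integral_Ioo]
      exact setIntegral_nonneg measurableSet_Ioo hf
    linarith
  · rw [intervalIntegral.integral_undef hi]

theorem rpow_mul_rpow_le_swap {s t a b : ℝ} (hs : 0 < s) (hst : s ≤ t) (hab : b ≤ a) :
    s ^ a * t ^ b ≤ t ^ a * s ^ b := by
  have ht : 0 < t := hs.trans_le hst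
  have split : ∀ x : ℝ, 0 < x → x ^ a = x ^ (a - b) * x ^ b := fun x hx => by
    rw [← Real.rpow_add hx, sub_add_cancel]
  rw [split s hs, split t ht, mul_assoc, mul_assoc, mul_comm (s ^ b)]
  exact mul_le_mul_of_nonneg_right (Real.rpow_le_rpow hs.le hst (sub_nonneg.2 hab))
    (by positivity)

theorem odd_pow_mul_rpow_swap_sub_nonneg {t a b : ℝ} (ht : t ∈ Set.Ioo (0 : ℝ) 1)
    (hab : b ≤ a) {k : ℕ} (hk : Odd k) :
    0 ≤ (2 * t - 1) ^ k * (t ^ a * (1 - t) ^ b - (1 - t) ^ a * t ^ b) := by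
  rcases le_total (1 - t) t with h | h
  · exact mul_nonneg (pow_nonneg (by linarith) k)
      (sub_nonneg.2 (rpow_mul_rpow_le_swap (sub_pos.2 ht.2) h hab))
  · exact mul_nonneg_of_nonpos_of_nonpos (hk.pow_nonpos (by linarith))
      (sub_nonpos.2 (rpow_mul_rpow_le_swap ht.1 h hab))

/-- Let `α, β > 0`, let `T` have the `Beta(α, β)` distribution (with density
`t^{α−1}(1−t)^{β−1}/B(α,β)` on `(0,1)`) and set `θ = 2T − 1`.  Then for every odd
positive integer `k`: `E(θ^k) ≥ 0` if `α ≥ β`, and `E(θ^k) ≤ 0` if `α ≤ β`. -/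
theorem beta_prior_odd_moment_sign (α β : ℝ) (hα : 0 < α) (hβ : 0 < β)
    (k : ℕ) (hk : Odd k) (hkpos : 0 < k) :
    (β ≤ α →
      0 ≤ ∫ t in Set.Ioo (0 : ℝ) 1, (2 * t - 1) ^ k *
          (t ^ (α - 1) * (1 - t) ^ (β - 1)
            / ∫ u in Set.Ioo (0 : ℝ) 1, u ^ (α - 1) * (1 - u) ^ (β - 1)))
    ∧ (α ≤ β →
      (∫ t in Set.Ioo (0 : ℝ) 1, (2 * t - 1) ^ k *
          (t ^ (α - 1) * (1 - t) ^ (β - 1)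
            / ∫ u in Set.Ioo (0 : ℝ) 1, u ^ (α - 1) * (1 - u) ^ (β - 1))) ≤ 0) := by
  have hB : 0 ≤ ∫ u in Set.Ioo (0 : ℝ) 1, u ^ (α - 1) * (1 - u) ^ (β - 1) :=
    setIntegral_nonneg measurableSet_Ioo fun u hu =>
      mul_nonneg (Real.rpow_nonneg hu.1.le _) (Real.rpow_nonneg (sub_pos.2 hu.2).le _)
  set B := ∫ u in Set.Ioo (0 : ℝ) 1, u ^ (α - 1) * (1 - u) ^ (β - 1)
  have reflect : ∀ t : ℝ, (2 * (1 - t) - 1) ^ k = -(2 * t - 1) ^ k := fun t => by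
    rw [← hk.neg_pow]
    ring
  constructor
  · intro h
    refine setIntegral_Ioo_nonneg_of_add_reflect_nonneg fun t ht => ?_
    refine (div_nonneg (odd_pow_mul_rpow_swap_sub_nonneg ht
      (sub_le_sub_right h 1) hk) hB).trans_eq ?_
    rw [reflect, sub_sub_cancel]
    ring
  · intro h
    rw [← neg_nonneg, ← integral_neg]
    refine setIntegral_Ioo_nonneg_of_add_reflect_nonneg fun t ht => ?_
    refine (div_nonneg (odd_pow_mul_rpow_swap_sub_nonneg ht
      (sub_le_sub_right h 1) hk) hB).trans_eq ?_
    rw [reflect, sub_sub_cancel]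
    ring
end

section
/- Let Δ = {w ∈ (0,1)^n : w_1 + ⋯ + w_n < 1} and fix w_0 = (w_{01},…,w_{0n}) ∈ Δ. Let W' be uniformly distributed on Δ (density n!·1_Δ) and let Λ be an independent random variable on (0,1) with density g. Then the random vector W = (1 − Λ) w_0 + Λ W' has Lebesgue density q(w | w_0) = n! · 1_Δ(w) · ∫_{1 − δ(w; w_0)}^{1} λ^{−n} g(λ) dλ, where δ(w; w_0) = min{ min_{1 ≤ i ≤ n} w_i / w_{0i}, (1 − Σ_{i=1}^n w_i) / (1 − Σ_{i=1}^n w_{0i}) }. -/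
open MeasureTheory ProbabilityTheory
open scoped ENNReal

/-- The open standard `n`-dimensional simplex `Δ = {w ∈ (0,1)ⁿ : w₁ + ⋯ + wₙ < 1}`. -/
def openSimplex (n : ℕ) : Set (Fin n → ℝ) :=
  {w | (∀ i, w i ∈ Set.Ioo (0 : ℝ) 1) ∧ ∑ i, w i < 1}

lemma mem_openSimplex_iff {n : ℕ} {w : Fin n → ℝ} :
    w ∈ openSimplex n ↔ (∀ i, 0 < w i) ∧ ∑ i, w i < 1 := by
  refine ⟨fun h => ⟨fun i => (h.1 i).1, h.2⟩, fun h => ⟨fun i => ⟨h.1 i, ?_⟩, h.2⟩⟩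
  exact (Finset.single_le_sum (fun j _ => (h.1 j).le) (Finset.mem_univ i)).trans_lt h.2

lemma measurableSet_openSimplex (n : ℕ) : MeasurableSet (openSimplex n) := by
  have : openSimplex n = (⋂ i, {w | 0 < w i}) ∩ {w | ∑ i, w i < 1} := by
    ext w; simp [mem_openSimplex_iff]
  rw [this]
  refine (MeasurableSet.iInter fun i => measurableSet_lt ?_ ?_).inter (measurableSet_lt ?_ ?_) <;>
    fun_prop

lemma lintegral_comp_add_smul {n : ℕ} (a : Fin n → ℝ) {r : ℝ} (hr : 0 < r)
    {f : (Fin n → ℝ) → ℝ≥0∞} (hf : Measurable f) :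
    ∫⁻ x, f (a + r • x) = ENNReal.ofReal (r ^ (-(n : ℤ))) * ∫⁻ x, f x := by
  have hf' : Measurable fun x => f (a + x) := by fun_prop
  rw [← lintegral_map (f := fun x => f (a + x)) hf' (measurable_const_smul r),
    Measure.map_addHaar_smul _ hr.ne', lintegral_smul_measure, lintegral_add_left_eq_self]
  simp [abs_of_pos hr]

lemma inv_smul_sub_mem_openSimplex_iff {n : ℕ} [NeZero n] {w₀ w : Fin n → ℝ}
    (hw₀ : w₀ ∈ openSimplex n) {l : ℝ} (hl : l ∈ Set.Ioo (0 : ℝ) 1) :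
    l⁻¹ • (w - (1 - l) • w₀) ∈ openSimplex n ↔
      w ∈ openSimplex n ∧
        1 - min (⨅ i, w i / w₀ i) ((1 - ∑ i, w i) / (1 - ∑ i, w₀ i)) < l := by
  obtain ⟨hl0, hl1⟩ := hl
  obtain ⟨hp, hs⟩ := mem_openSimplex_iff.1 hw₀
  have hinf : 1 - l < ⨅ i, w i / w₀ i ↔ ∀ i, 1 - l < w i / w₀ i := by
    refine ⟨fun h i => h.trans_le (ciInf_le (Set.finite_range _).bddBelow i), fun h => ?_⟩
    obtain ⟨i, hi⟩ := exists_eq_ciInf_of_finite (f := fun i => w i / w₀ i)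
    exact hi ▸ h i
  have hsum : ∑ i, (l⁻¹ • (w - (1 - l) • w₀)) i = l⁻¹ * (∑ i, w i - (1 - l) * ∑ i, w₀ i) := by
    simp [← Finset.mul_sum]
  rw [sub_lt_comm, lt_min_iff, hinf, lt_div_iff₀ (by linarith), mem_openSimplex_iff,
    mem_openSimplex_iff, hsum, inv_mul_lt_iff₀ hl0]
  simp only [Pi.smul_apply, Pi.sub_apply, smul_eq_mul, lt_div_iff₀ (hp _),
    mul_pos_iff_of_pos_left (inv_pos.2 hl0), sub_pos]
  constructor
  · rintro ⟨h1, h2⟩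
    have h3 : 0 < (1 - l) * (1 - ∑ i, w₀ i) := mul_pos (by linarith) (by linarith)
    refine ⟨⟨fun i => (mul_pos (by linarith) (hp i)).trans (h1 i), by linarith⟩, h1, by linarith⟩
  · rintro ⟨-, h1, h2⟩
    exact ⟨h1, by linarith⟩

lemma min_iInf_div_lt_one {n : ℕ} {w₀ w : Fin n → ℝ}
    (hw₀ : w₀ ∈ openSimplex n) (hne : w ≠ w₀) :
    min (⨅ i, w i / w₀ i) ((1 - ∑ i, w i) / (1 - ∑ i, w₀ i)) < 1 := by
  obtain ⟨hp, hs⟩ := mem_openSimplex_iff.1 hw₀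
  by_contra! h
  obtain ⟨h1, h2⟩ := le_min_iff.1 h
  have hle : ∀ i, w₀ i ≤ w i := fun i =>
    (one_le_div (hp i)).1 (h1.trans (ciInf_le (Set.finite_range _).bddBelow i))
  rw [one_le_div (by linarith)] at h2
  have heq := (Finset.sum_eq_sum_iff_of_le fun i _ => hle i).1
    (le_antisymm (Finset.sum_le_sum fun i _ => hle i) (by linarith))
  exact hne (funext fun i => (heq i (Finset.mem_univ i)).symm)

lemma integrableOn_zpow_neg_mul {g : ℝ → ℝ} (hg : Integrable g) {a : ℝ} (ha : 0 < a) (n : ℕ) :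
    IntegrableOn (fun l => l ^ (-(n : ℤ)) * g l) (Set.Ioo a 1) := by
  refine hg.integrableOn.bdd_mul (c := a ^ (-(n : ℤ)))
    (by fun_prop : Measurable fun l : ℝ => l ^ (-(n : ℤ))).aestronglyMeasurable ?_
  filter_upwards [ae_restrict_mem measurableSet_Ioo] with l hl
  have hl0 : 0 < l := ha.trans hl.1
  rw [Real.norm_of_nonneg (zpow_nonneg hl0.le _), zpow_neg, zpow_neg, zpow_natCast, zpow_natCast]
  gcongr
  exact hl.1.le

/-- If `X` has density `D` and `Λ` is independent of `X` with a density `ρ` supported on the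
positive reals, then `(1 - Λ) w₀ + Λ X` has density `w ↦ ∫ ρ(l) l⁻ⁿ D((w - (1 - l) w₀) / l) dl`. -/
lemma map_affine_mixture_eq_withDensity {n : ℕ} (w₀ : Fin n → ℝ)
    {Ω : Type*} [MeasurableSpace Ω] {P : Measure Ω} [IsFiniteMeasure P]
    {X : Ω → Fin n → ℝ} {Λ : Ω → ℝ} {D : (Fin n → ℝ) → ℝ≥0∞} {ρ : ℝ → ℝ≥0∞}
    (hX : Measurable X) (hΛ : Measurable Λ) (hD : Measurable D) (hρ : Measurable ρ)
    (hρ0 : ∀ l ≤ 0, ρ l = 0)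
    (hXlaw : P.map X = volume.withDensity D) (hΛlaw : P.map Λ = volume.withDensity ρ)
    (hindep : IndepFun Λ X P) :
    P.map (fun ω => fun i => (1 - Λ ω) * w₀ i + Λ ω * X ω i) =
      volume.withDensity fun w =>
        ∫⁻ l, ρ l * (ENNReal.ofReal (l ^ (-(n : ℤ))) * D (l⁻¹ • (w - (1 - l) • w₀))) := by
  have hφ : Measurable fun p : ℝ × (Fin n → ℝ) => (1 - p.1) • w₀ + p.1 • p.2 := by fun_prop
  have hK : Measurable fun p : ℝ × (Fin n → ℝ) =>
      ρ p.1 * (ENNReal.ofReal (p.1 ^ (-(n : ℤ))) * D (p.1⁻¹ • (p.2 - (1 - p.1) • w₀))) := by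
    fun_prop
  have hcomp : (fun ω => fun i => (1 - Λ ω) * w₀ i + Λ ω * X ω i) =
      (fun p : ℝ × (Fin n → ℝ) => (1 - p.1) • w₀ + p.1 • p.2) ∘ fun ω => (Λ ω, X ω) := by
    ext ω i; simp
  rw [hcomp, ← Measure.map_map hφ (hΛ.prodMk hX),
    (indepFun_iff_map_prod_eq_prod_map_map hΛ.aemeasurable hX.aemeasurable).1 hindep,
    hXlaw, hΛlaw]
  refine Measure.ext_of_lintegral _ fun h hh => ?_
  have hF : Measurable fun p : ℝ × (Fin n → ℝ) => h ((1 - p.1) • w₀ + p.1 • p.2) := hh.comp hφ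
  rw [lintegral_map hh hφ, lintegral_prod _ hF.aemeasurable,
    lintegral_withDensity_eq_lintegral_mul _ hρ hF.lintegral_prod_right',
    lintegral_withDensity_eq_lintegral_mul _ hK.lintegral_prod_left' hh]
  simp only [Pi.mul_apply]
  have hsection : ∀ l : ℝ,
      ρ l * ∫⁻ x, h ((1 - l) • w₀ + l • x) ∂volume.withDensity D =
        ∫⁻ w, ρ l * (ENNReal.ofReal (l ^ (-(n : ℤ))) * D (l⁻¹ • (w - (1 - l) • w₀))) * h w := by
    intro l
    rcases le_or_gt l 0 with hl | hl
    · simp [hρ0 l hl]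
    have hG : Measurable fun w => D (l⁻¹ • (w - (1 - l) • w₀)) * h w := by fun_prop
    rw [lintegral_withDensity_eq_lintegral_mul _ hD (by fun_prop)]
    have hcv := lintegral_comp_add_smul ((1 - l) • w₀) hl hG
    simp only [add_sub_cancel_left, inv_smul_smul₀ hl.ne'] at hcv
    simp only [Pi.mul_apply, mul_assoc]
    rw [hcv, lintegral_const_mul _ (by fun_prop), lintegral_const_mul _ hG]
  simp only [hsection]
  rw [lintegral_lintegral_swap]
  · exact lintegral_congr fun w => lintegral_mul_const _ (hK.comp measurable_prodMk_right)
  · exact (hK.mul (hh.comp measurable_snd)).aemeasurable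

/-- Let `Δ` be the open standard simplex and fix `w₀ ∈ Δ`.  Let `W'` be uniformly
distributed on `Δ` (density `n!·1_Δ`), and let `Λ` be an independent random variable
on `(0,1)` with density `g`.  Then `W = (1 − Λ) w₀ + Λ W'` has Lebesgue density
`q(w ∣ w₀) = n! · 1_Δ(w) · ∫_{1−δ(w;w₀)}^1 λ^{−n} g(λ) dλ`, where
`δ(w; w₀) = min{ minᵢ wᵢ/w₀ᵢ, (1 − ∑ᵢ wᵢ)/(1 − ∑ᵢ w₀ᵢ) }`. -/
theorem instrumental_density (n : ℕ) (hn : 0 < n)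
    (w₀ : Fin n → ℝ) (hw₀ : w₀ ∈ openSimplex n)
    {Ω : Type*} [MeasurableSpace Ω] (P : Measure Ω) [IsProbabilityMeasure P]
    (W' : Ω → Fin n → ℝ) (Λ : Ω → ℝ) (g : ℝ → ℝ)
    (hW'meas : Measurable W') (hΛmeas : Measurable Λ) (hgmeas : Measurable g)
    (hgnonneg : ∀ x, 0 ≤ g x) (hg0 : ∀ x ∉ Set.Ioo (0 : ℝ) 1, g x = 0)
    (hW'law : Measure.map W' P
      = volume.withDensity
          ((openSimplex n).indicator fun _ => (Nat.factorial n : ℝ≥0∞)))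
    (hΛlaw : Measure.map Λ P = volume.withDensity fun x => ENNReal.ofReal (g x))
    (hindep : IndepFun Λ W' P) :
    Measure.map (fun ω => fun i => (1 - Λ ω) * w₀ i + Λ ω * W' ω i) P
      = volume.withDensity
          ((openSimplex n).indicator fun w =>
            ENNReal.ofReal ((Nat.factorial n : ℝ) *
              ∫ l in Set.Ioo
                  (1 - min (⨅ i, w i / w₀ i)
                    ((1 - ∑ i, w i) / (1 - ∑ i, w₀ i))) 1,
                l ^ (-(n : ℤ)) * g l)) := by
  have : NeZero n := ⟨hn.ne'⟩
  have hgint : Integrable g := by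
    refine ⟨hgmeas.aestronglyMeasurable, ?_⟩
    rw [hasFiniteIntegral_iff_ofReal (Filter.Eventually.of_forall hgnonneg), ← setLIntegral_univ,
      ← withDensity_apply _ MeasurableSet.univ, ← hΛlaw]
    exact measure_lt_top _ _
  rw [map_affine_mixture_eq_withDensity w₀ hW'meas hΛmeas
    (measurable_const.indicator (measurableSet_openSimplex n)) hgmeas.ennreal_ofReal
    (fun l hl => by simp [hg0 l fun h => h.1.not_ge hl]) hW'law hΛlaw hindep]
  refine withDensity_congr_ae ?_
  filter_upwards [Measure.ae_ne volume w₀] with w hw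
  set a := 1 - min (⨅ i, w i / w₀ i) ((1 - ∑ i, w i) / (1 - ∑ i, w₀ i)) with ha
  have ha0 : 0 < a := sub_pos.2 (min_iInf_div_lt_one hw₀ hw)
  have hK : ∀ l, ENNReal.ofReal (g l) * (ENNReal.ofReal (l ^ (-(n : ℤ))) *
        (openSimplex n).indicator (fun _ => (n.factorial : ℝ≥0∞)) (l⁻¹ • (w - (1 - l) • w₀))) =
      (openSimplex n).indicator (fun _ => (n.factorial : ℝ≥0∞)) w *
        (Set.Ioo a 1).indicator (fun l => ENNReal.ofReal (l ^ (-(n : ℤ)) * g l)) l := by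
    intro l
    by_cases hl : l ∈ Set.Ioo (0 : ℝ) 1
    · have hmem := inv_smul_sub_mem_openSimplex_iff (w := w) hw₀ hl
      have hla : l ∈ Set.Ioo a 1 ↔ a < l := and_iff_left hl.2
      rw [← ha] at hmem
      by_cases hwΔ : w ∈ openSimplex n
      · by_cases hal : a < l
        · rw [Set.indicator_of_mem (hmem.2 ⟨hwΔ, hal⟩), Set.indicator_of_mem hwΔ,
            Set.indicator_of_mem (hla.2 hal), ENNReal.ofReal_mul (zpow_nonneg hl.1.le _)]
          ring
        · rw [Set.indicator_of_notMem fun h => hal (hmem.1 h).2,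
            Set.indicator_of_notMem fun h => hal (hla.1 h)]
          simp
      · rw [Set.indicator_of_notMem fun h => hwΔ (hmem.1 h).1, Set.indicator_of_notMem hwΔ]
        simp
    · have hla : l ∉ Set.Ioo a 1 := fun h => hl ⟨ha0.trans h.1, h.2⟩
      simp [hg0 l hl, hla]
  have hnonneg : ∀ᵐ l ∂volume.restrict (Set.Ioo a 1), 0 ≤ l ^ (-(n : ℤ)) * g l := by
    filter_upwards [ae_restrict_mem measurableSet_Ioo] with l hl
    exact mul_nonneg (zpow_nonneg (ha0.trans hl.1).le _) (hgnonneg l)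
  simp only [hK]
  rw [lintegral_const_mul _ (by
      exact Measurable.indicator (by fun_prop) measurableSet_Ioo),
    lintegral_indicator measurableSet_Ioo,
    ← ofReal_integral_eq_lintegral_ofReal (integrableOn_zpow_neg_mul hgint ha0 n) hnonneg]
  by_cases hwΔ : w ∈ openSimplex n
  · simp [hwΔ, ← ha, ENNReal.ofReal_mul]
  · simp [hwΔ]
end
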